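/- Let ν be a charge distribution on ℂ concentrated in the open right half-plane {Re z > 0} with finite total variation |ν|(ℂ) < +∞. Then for Lebesgue-almost every y ∈ ℝ the integral g(y) := (1/π)∫_ℂ Re(1/(z−iy)) dν(z) converges absolutely, g is Lebesgue integrable on ℝ with ∫_ℝ |g(y)| dy ≤ |ν|(ℂ), and if ν is a positive measure then ∫_ℝ g(y) dy = ν(ℂ). -/

import Mathlib

open MeasureTheory Filter Set

/-- On the open right half-plane, `Re (1 / (z - iy))` is `π` times the Cauchy density with
location `Im z` and scale `Re z`. -/
lemma re_one_div_sub_I_mul_eq_cauchyPDFReal {z : ℂ} (hz : 0 < z.re) (y : ℝ) :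
    (1 / (z - Complex.I * (y : ℂ))).re =
      Real.pi * ProbabilityTheory.cauchyPDFReal z.im z.re.toNNReal y := by
  rw [ProbabilityTheory.cauchyPDFReal_def, Real.coe_toNNReal _ hz.le, one_div, Complex.inv_re,
    Complex.normSq_apply]
  have hπ := Real.pi_ne_zero
  simp only [Complex.sub_re, Complex.sub_im, Complex.mul_re, Complex.mul_im, Complex.I_re,
    Complex.I_im, Complex.ofReal_re, Complex.ofReal_im]
  rw [mul_assoc, mul_inv_cancel_left₀ hπ, div_eq_mul_inv]
  ring_nf

lemma re_one_div_sub_I_mul_nonneg {z : ℂ} (hz : 0 < z.re) (y : ℝ) :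
    0 ≤ (1 / (z - Complex.I * (y : ℂ))).re := by
  rw [one_div, Complex.inv_re]
  exact div_nonneg (by simpa using hz.le) (Complex.normSq_nonneg _)

lemma integrable_re_one_div_sub_I_mul {z : ℂ} (hz : 0 < z.re) :
    Integrable fun y : ℝ => (1 / (z - Complex.I * (y : ℂ))).re := by
  simp only [re_one_div_sub_I_mul_eq_cauchyPDFReal hz]
  exact (ProbabilityTheory.integrable_cauchyPDFReal _).const_mul _

lemma integral_re_one_div_sub_I_mul {z : ℂ} (hz : 0 < z.re) :
    ∫ y : ℝ, (1 / (z - Complex.I * (y : ℂ))).re = Real.pi := by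
  simp only [re_one_div_sub_I_mul_eq_cauchyPDFReal hz]
  rw [integral_const_mul, ProbabilityTheory.integral_cauchyPDFReal_eq_one _ (by simpa using hz),
    mul_one]

lemma integrable_prod_re_one_div_sub_I_mul {μ : Measure ℂ} [IsFiniteMeasure μ]
    (hμ : ∀ᵐ z ∂μ, 0 < z.re) :
    Integrable (fun p : ℂ × ℝ => (1 / (p.1 - Complex.I * (p.2 : ℂ))).re) (μ.prod volume) := by
  have hmeas : Measurable fun p : ℂ × ℝ => (1 / (p.1 - Complex.I * (p.2 : ℂ))).re := by
    fun_prop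
  rw [integrable_prod_iff hmeas.aestronglyMeasurable]
  refine ⟨hμ.mono fun z hz => integrable_re_one_div_sub_I_mul hz,
    (integrable_const Real.pi).congr (hμ.mono fun z hz => ?_)⟩
  simp only [Real.norm_of_nonneg (re_one_div_sub_I_mul_nonneg hz _)]
  exact (integral_re_one_div_sub_I_mul hz).symm

lemma integral_integral_re_one_div_sub_I_mul {μ : Measure ℂ} [IsFiniteMeasure μ]
    (hμ : ∀ᵐ z ∂μ, 0 < z.re) :
    ∫ y : ℝ, ∫ z, (1 / (z - Complex.I * (y : ℂ))).re ∂μ = Real.pi * μ.real univ := by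
  rw [← integral_integral_swap (integrable_prod_re_one_div_sub_I_mul hμ),
    integral_congr_ae (hμ.mono fun z hz => integral_re_one_div_sub_I_mul hz)]
  simp [mul_comm]

/-- Let `ν = νp - νn` be a charge distribution concentrated in the open
right half-plane with finite total variation. Then for Lebesgue-a.e. `y ∈ ℝ` the
integral `g(y) := (1/π)∫ Re(1/(z−iy)) dν(z)` converges absolutely, `g` is Lebesgue
integrable on `ℝ` with `∫|g| ≤ |ν|(ℂ)`, and if `ν` is a positive measure (`νn = 0`)
then `∫ g = ν(ℂ)`. -/
theorem balayage_density_integrable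
    (νp νn : Measure ℂ) [IsLocallyFiniteMeasure νp] [IsLocallyFiniteMeasure νn]
    (hsing : νp ⟂ₘ νn)
    (hconc : (νp + νn) {z : ℂ | 0 < z.re}ᶜ = 0)
    (hfin : (νp + νn) univ < ⊤)
    (g : ℝ → ℝ)
    (hg : g = fun y : ℝ => (1 / Real.pi) *
      ((∫ z, (1 / (z - Complex.I * (y : ℂ))).re ∂νp) -
        ∫ z, (1 / (z - Complex.I * (y : ℂ))).re ∂νn)) :
    (∀ᵐ y : ℝ ∂volume,
        Integrable (fun z : ℂ => (1 / (z - Complex.I * y)).re) (νp + νn))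
    ∧ Integrable g volume
    ∧ (∫ y : ℝ, |g y|) ≤ ((νp + νn) univ).toReal
    ∧ (νn = 0 → (∫ y : ℝ, g y) = (νp univ).toReal) := by
  have : IsFiniteMeasure (νp + νn) := ⟨hfin⟩
  have : IsFiniteMeasure νp := isFiniteMeasure_of_le (νp + νn) (Measure.le_add_right le_rfl)
  have : IsFiniteMeasure νn := isFiniteMeasure_of_le (νp + νn) (Measure.le_add_left le_rfl)
  have hsum : ∀ᵐ z ∂(νp + νn), 0 < z.re := hconc
  obtain ⟨hp, hn⟩ := ae_add_measure_iff.mp hsum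
  have hP := (integrable_prod_re_one_div_sub_I_mul hp).integral_prod_right
  have hN := (integrable_prod_re_one_div_sub_I_mul hn).integral_prod_right
  have hPint := integral_integral_re_one_div_sub_I_mul hp
  have hNint := integral_integral_re_one_div_sub_I_mul hn
  have hπ := Real.pi_pos
  have hgint : Integrable g := hg ▸ (hP.sub hN).const_mul _
  refine ⟨(integrable_prod_re_one_div_sub_I_mul hsum).prod_left_ae, hgint, ?_, ?_⟩
  · calc ∫ y, |g y|
        ≤ ∫ y : ℝ, (1 / Real.pi) * ((∫ z, (1 / (z - Complex.I * (y : ℂ))).re ∂νp) +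
            ∫ z, (1 / (z - Complex.I * (y : ℂ))).re ∂νn) := by
          refine integral_mono hgint.abs ((hP.add hN).const_mul _) fun y => ?_
          have hp0 : 0 ≤ ∫ z, (1 / (z - Complex.I * (y : ℂ))).re ∂νp :=
            integral_nonneg_of_ae (hp.mono fun z hz => re_one_div_sub_I_mul_nonneg hz y)
          have hn0 : 0 ≤ ∫ z, (1 / (z - Complex.I * (y : ℂ))).re ∂νn :=
            integral_nonneg_of_ae (hn.mono fun z hz => re_one_div_sub_I_mul_nonneg hz y)
          simp only [hg, abs_mul, abs_of_pos (one_div_pos.mpr hπ)]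
          gcongr
          exact abs_le.mpr ⟨by linarith, by linarith⟩
      _ = ((νp + νn) univ).toReal := by
          rw [integral_const_mul, integral_add hP hN, hPint, hNint, Measure.add_apply,
            ENNReal.toReal_add (measure_ne_top _ _) (measure_ne_top _ _)]
          simp only [Measure.real]
          field_simp
  · rintro rfl
    simp only [hg, integral_zero_measure, sub_zero]
    rw [integral_const_mul, hPint, Measure.real]
    field_simp
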